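/- arXiv:1702.08264 — 2 statements merged into one kernel-verified Lean document; each statement's English description precedes it below -/
import Mathlib

section
/- Let V be a finite-dimensional real inner product space and let Σ ⊆ V be a finite set of nonzero vectors such that (i) there exists a linear functional f on V with f(σ) > 0 for every σ ∈ Σ, and (ii) for all distinct σ, τ ∈ Σ the number 2(σ,τ)/(τ,τ) is a nonpositive integer. Then Σ is linearly independent and Σ is the base of a finite reduced crystallographic root system contained in the ℤ-span of Σ; concretely, the set Φ = W·Σ, where W is the group generated by the reflections s_σ for σ ∈ Σ, is a finite reduced crystallographic root system in the span of Σ having Σ as a base. -/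
open RealInnerProductSpace

variable {V : Type*} [NormedAddCommGroup V] [InnerProductSpace ℝ V]

/-- The pairing `⟨x | v∨⟩ = 2(x,v)/(v,v)` of a vector against the "coroot" of `v`. -/
noncomputable def pairR (x v : V) : ℝ := 2 * ⟪x, v⟫ / ⟪v, v⟫

/-- The reflection `s_v(x) = x - ⟨x|v∨⟩ v` in the nonzero vector `v`. -/
noncomputable def reflV (v x : V) : V := x - pairR x v • v

/-- A finite reduced crystallographic root system in a real inner product space:
a finite set of nonzero vectors, closed under all of its reflections, with integral
Cartan numbers, such that the only multiples of a root `α` that are roots are `±α`. -/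
def IsRootSystem (Φ : Set V) : Prop :=
  Φ.Finite ∧
  (0 : V) ∉ Φ ∧
  (∀ α ∈ Φ, ∀ β ∈ Φ, reflV α β ∈ Φ) ∧
  (∀ α ∈ Φ, ∀ β ∈ Φ, ∃ n : ℤ, pairR β α = (n : ℝ)) ∧
  (∀ α ∈ Φ, ∀ c : ℝ, c • α ∈ Φ → c • α = α ∨ c • α = -α)

/-- `S` is a base of `Φ`: a linearly independent subset spanning the span of `Φ`
such that every element of `Φ` is an integral linear combination of `S` with
coefficients all of the same sign. -/
def IsBase (Φ S : Set V) : Prop :=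
  S ⊆ Φ ∧
  LinearIndependent ℝ ((↑) : S → V) ∧
  Submodule.span ℝ S = Submodule.span ℝ Φ ∧
  ∀ α ∈ Φ, ∃ c : V →₀ ℤ,
    (↑c.support : Set V) ⊆ S ∧
    α = c.sum (fun v n => (n : ℝ) • v) ∧
    ((∀ v, 0 ≤ c v) ∨ (∀ v, c v ≤ 0))

/-- The positive elements with respect to a base `S`: nonnegative integral
combinations of `S`. -/
def IsPositive (S : Set V) (α : V) : Prop :=
  ∃ c : V →₀ ℤ,
    (↑c.support : Set V) ⊆ S ∧
    α = c.sum (fun v n => (n : ℝ) • v) ∧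
    (∀ v, 0 ≤ c v)

/-- `Ψ` is a root subsystem of `Φ`: a nonempty subset stable under its own reflections. -/
def IsRootSubsystem (Φ Ψ : Set V) : Prop :=
  Ψ ⊆ Φ ∧ Ψ.Nonempty ∧ ∀ ψ ∈ Ψ, ∀ x ∈ Ψ, reflV ψ x ∈ Ψ

/-- `Ψ` is additively closed in `Φ` : `Ψ = Φ ∩ ℤΨ`. -/
def IsAddClosedIn (Φ Ψ : Set V) : Prop :=
  Ψ = Φ ∩ (Submodule.span ℤ Ψ : Set V)

/-- The group generated by the reflections `s_σ`, `σ ∈ Sg`, inside the group of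
linear automorphisms of `V`. -/
noncomputable def WGroup (Sg : Set V) : Subgroup (V ≃ₗ[ℝ] V) :=
  Subgroup.closure {w | ∃ σ ∈ Sg, ∀ x : V, w x = reflV σ x}

/-- The orbit `W·Σ` of `Σ` under the group generated by the reflections in
the elements of `Σ`. -/
noncomputable def WOrbit (Sg : Set V) : Set V :=
  {x | ∃ w ∈ WGroup Sg, ∃ σ ∈ Sg, x = w σ}

section Pairing

lemma pairR_sub (x y v : V) : pairR (x - y) v = pairR x v - pairR y v := by
  simp only [pairR, inner_sub_left]; ring

lemma pairR_add (x y v : V) : pairR (x + y) v = pairR x v + pairR y v := by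
  simp only [pairR, inner_add_left]; ring

lemma pairR_smul (c : ℝ) (x v : V) : pairR (c • x) v = c * pairR x v := by
  simp only [pairR, real_inner_smul_left]; ring

lemma pairR_self {v : V} (hv : v ≠ 0) : pairR v v = 2 := by
  have : ⟪v, v⟫ ≠ 0 := inner_self_ne_zero.mpr hv
  simp only [pairR]; field_simp

lemma pairR_reflV_self {v : V} (hv : v ≠ 0) (x : V) : pairR (reflV v x) v = -pairR x v := by
  rw [reflV, pairR_sub, pairR_smul, pairR_self hv]; ring

lemma reflV_reflV {v : V} (hv : v ≠ 0) (x : V) : reflV v (reflV v x) = x := by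
  rw [reflV, pairR_reflV_self hv, reflV]; simp

lemma inner_reflV_reflV {v : V} (hv : v ≠ 0) (x y : V) : ⟪reflV v x, reflV v y⟫ = ⟪x, y⟫ := by
  have : ⟪v, v⟫ ≠ 0 := inner_self_ne_zero.mpr hv
  simp only [reflV, pairR, inner_sub_left, inner_sub_right, real_inner_smul_left,
    real_inner_smul_right, real_inner_comm v x, real_inner_comm y v]
  field_simp
  ring

/-- The pairing against the coroot of `v`, as a linear functional. -/
noncomputable def pairingFunctional (v : V) : V →ₗ[ℝ] ℝ where
  toFun x := pairR x v
  map_add' x y := pairR_add x y v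
  map_smul' c x := by simp [pairR_smul]

/-- The reflection in a nonzero vector, as a linear automorphism. -/
noncomputable def reflEquiv {v : V} (hv : v ≠ 0) : V ≃ₗ[ℝ] V :=
  Module.reflection (x := v) (f := pairingFunctional v) (pairR_self hv)

lemma reflEquiv_apply {v : V} (hv : v ≠ 0) (x : V) : reflEquiv hv x = reflV v x :=
  Module.reflection_apply _ _

end Pairing

section Dihedral

/-- The orbit of a dominant weight under a crystallographic dihedral group, in coordinates: the
weight minus `u` times the first simple root minus `v` times the second one is represented by
`(u, v)`. Each point of the orbit is reached from the weight by coordinate-increasing reflections. -/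
lemma exists_stable_of_le {a b p q : ℤ} (hp : 0 ≤ p) (hq : 0 ≤ q)
    (hab : (a = 0 ∧ b = 0) ∨ (a = 1 ∧ b = 1) ∨ (a = 1 ∧ b = 2) ∨ (a = 1 ∧ b = 3))
    (P : ℤ → ℤ → Prop) (h0 : P 0 0)
    (hS : ∀ u v u', P u v → u' = p - u + b * v → u ≤ u' → P u' v)
    (hT : ∀ u v v', P u v → v' = q - v + a * u → v ≤ v' → P u v') :
    ∃ U : ℤ → ℤ → Prop, U 0 0 ∧ (∀ u v, U u v → P u v) ∧
      (∀ u v, U u v → U (p - u + b * v) v) ∧ (∀ u v, U u v → U u (q - v + a * u)) := by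
  have hs := hS 0 0 p h0 (by omega) hp
  have ht := hT 0 0 q h0 (by omega) hq
  rcases hab with ⟨rfl, rfl⟩ | ⟨rfl, rfl⟩ | ⟨rfl, rfl⟩ | ⟨rfl, rfl⟩
  · have hts := hT _ _ q hs (by omega) (by omega)
    refine ⟨fun u v ↦ (u = 0 ∧ v = 0) ∨ (u = p ∧ v = 0) ∨ (u = 0 ∧ v = q) ∨ (u = p ∧ v = q),
      by simp, ?_, ?_, ?_⟩
    · rintro u v (⟨rfl, rfl⟩ | ⟨rfl, rfl⟩ | ⟨rfl, rfl⟩ | ⟨rfl, rfl⟩) <;> assumption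
    all_goals
      rintro u v (⟨rfl, rfl⟩ | ⟨rfl, rfl⟩ | ⟨rfl, rfl⟩ | ⟨rfl, rfl⟩) <;> grind
  · have hts := hT _ _ (p + q) hs (by omega) (by omega)
    have hsts := hS _ _ (p + q) hts (by omega) (by omega)
    have hst := hS _ _ (p + q) ht (by omega) (by omega)
    refine ⟨fun u v ↦ (u = 0 ∧ v = 0) ∨ (u = p ∧ v = 0) ∨ (u = 0 ∧ v = q) ∨
      (u = p ∧ v = p + q) ∨ (u = p + q ∧ v = q) ∨ (u = p + q ∧ v = p + q), by simp, ?_, ?_, ?_⟩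
    · rintro u v (⟨rfl, rfl⟩ | ⟨rfl, rfl⟩ | ⟨rfl, rfl⟩ | ⟨rfl, rfl⟩ | ⟨rfl, rfl⟩ | ⟨rfl, rfl⟩) <;>
        assumption
    all_goals
      rintro u v (⟨rfl, rfl⟩ | ⟨rfl, rfl⟩ | ⟨rfl, rfl⟩ | ⟨rfl, rfl⟩ | ⟨rfl, rfl⟩ | ⟨rfl, rfl⟩) <;> grind
  · have hts := hT _ _ (p + q) hs (by omega) (by omega)
    have hsts := hS _ _ (2 * p + 2 * q) hts (by omega) (by omega)
    have htsts := hT _ _ (p + 2 * q) hsts (by omega) (by omega)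
    have hst := hS _ _ (p + 2 * q) ht (by omega) (by omega)
    have htst := hT _ _ (p + 2 * q) hst (by omega) (by omega)
    refine ⟨fun u v ↦ (u = 0 ∧ v = 0) ∨ (u = p ∧ v = 0) ∨ (u = 0 ∧ v = q) ∨
      (u = p ∧ v = p + q) ∨ (u = 2 * p + 2 * q ∧ v = p + q) ∨ (u = p + 2 * q ∧ v = q) ∨
      (u = p + 2 * q ∧ v = p + 2 * q) ∨ (u = 2 * p + 2 * q ∧ v = p + 2 * q), by simp, ?_, ?_, ?_⟩
    · rintro u v (⟨rfl, rfl⟩ | ⟨rfl, rfl⟩ | ⟨rfl, rfl⟩ | ⟨rfl, rfl⟩ | ⟨rfl, rfl⟩ | ⟨rfl, rfl⟩ |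
        ⟨rfl, rfl⟩ | ⟨rfl, rfl⟩) <;> assumption
    all_goals
      rintro u v (⟨rfl, rfl⟩ | ⟨rfl, rfl⟩ | ⟨rfl, rfl⟩ | ⟨rfl, rfl⟩ |
        ⟨rfl, rfl⟩ | ⟨rfl, rfl⟩ | ⟨rfl, rfl⟩ | ⟨rfl, rfl⟩) <;>
        ring_nf <;> simp
  · have hts := hT _ _ (p + q) hs (by omega) (by omega)
    have hsts := hS _ _ (3 * p + 3 * q) hts (by omega) (by omega)
    have htsts := hT _ _ (2 * p + 3 * q) hsts (by omega) (by omega)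
    have hststs := hS _ _ (4 * p + 6 * q) htsts (by omega) (by omega)
    have hlong := hT _ _ (2 * p + 4 * q) hststs (by omega) (by omega)
    have hst := hS _ _ (p + 3 * q) ht (by omega) (by omega)
    have htst := hT _ _ (p + 3 * q) hst (by omega) (by omega)
    have hstst := hS _ _ (3 * p + 6 * q) htst (by omega) (by omega)
    have htstst := hT _ _ (2 * p + 4 * q) hstst (by omega) (by omega)
    refine ⟨fun u v ↦ (u = 0 ∧ v = 0) ∨ (u = p ∧ v = 0) ∨ (u = 0 ∧ v = q) ∨
      (u = p ∧ v = p + q) ∨ (u = 3 * p + 3 * q ∧ v = p + q) ∨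
      (u = 3 * p + 3 * q ∧ v = 2 * p + 3 * q) ∨ (u = 4 * p + 6 * q ∧ v = 2 * p + 3 * q) ∨
      (u = p + 3 * q ∧ v = q) ∨ (u = p + 3 * q ∧ v = p + 3 * q) ∨
      (u = 3 * p + 6 * q ∧ v = p + 3 * q) ∨ (u = 3 * p + 6 * q ∧ v = 2 * p + 4 * q) ∨
      (u = 4 * p + 6 * q ∧ v = 2 * p + 4 * q), by simp, ?_, ?_, ?_⟩
    · rintro u v (⟨rfl, rfl⟩ | ⟨rfl, rfl⟩ | ⟨rfl, rfl⟩ | ⟨rfl, rfl⟩ | ⟨rfl, rfl⟩ | ⟨rfl, rfl⟩ |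
        ⟨rfl, rfl⟩ | ⟨rfl, rfl⟩ | ⟨rfl, rfl⟩ | ⟨rfl, rfl⟩ | ⟨rfl, rfl⟩ | ⟨rfl, rfl⟩) <;> assumption
    all_goals
      rintro u v (⟨rfl, rfl⟩ | ⟨rfl, rfl⟩ | ⟨rfl, rfl⟩ | ⟨rfl, rfl⟩ | ⟨rfl, rfl⟩ | ⟨rfl, rfl⟩ |
        ⟨rfl, rfl⟩ | ⟨rfl, rfl⟩ | ⟨rfl, rfl⟩ | ⟨rfl, rfl⟩ | ⟨rfl, rfl⟩ | ⟨rfl, rfl⟩) <;>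
        ring_nf <;> simp

lemma exists_stable {a b p q : ℤ} (hp : 0 ≤ p) (hq : 0 ≤ q) (ha : 0 ≤ a) (hb : 0 ≤ b)
    (hab : a * b < 4) (hab0 : a = 0 ↔ b = 0)
    (P : ℤ → ℤ → Prop) (h0 : P 0 0)
    (hS : ∀ u v u', P u v → u' = p - u + b * v → u ≤ u' → P u' v)
    (hT : ∀ u v v', P u v → v' = q - v + a * u → v ≤ v' → P u v') :
    ∃ U : ℤ → ℤ → Prop, U 0 0 ∧ (∀ u v, U u v → P u v) ∧
      (∀ u v, U u v → U (p - u + b * v) v) ∧ (∀ u v, U u v → U u (q - v + a * u)) := by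
  have key : (a = 0 ∧ b = 0) ∨ (a = 1 ∧ (b = 1 ∨ b = 2 ∨ b = 3)) ∨
      (b = 1 ∧ (a = 1 ∨ a = 2 ∨ a = 3)) := by
    rcases eq_or_lt_of_le ha with h | h
    · exact Or.inl ⟨h.symm, hab0.mp h.symm⟩
    have hb' : 0 < b := lt_of_le_of_ne hb fun h' ↦ h.ne' (hab0.mpr h'.symm)
    have ha4 : a < 4 := by nlinarith
    have hb4 : b < 4 := by nlinarith
    interval_cases a <;> interval_cases b <;> simp_all
  by_cases h : a ≤ b
  · exact exists_stable_of_le hp hq (by omega) P h0 hS hT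
  · obtain ⟨U, hU0, hUP, hUT, hUS⟩ := exists_stable_of_le (a := b) (b := a) hq hp (by omega)
      (fun u v ↦ P v u) h0 (fun u v u' ↦ hT v u u') (fun u v v' ↦ hS v u v')
    exact ⟨fun u v ↦ U v u, hU0, fun u v ↦ hUP v u, fun u v ↦ hUS v u, fun u v ↦ hUT v u⟩

end Dihedral

/-- The vectors obtained from `l` by successively applying reflections in elements `σ` of `Sg`
to vectors that pair positively with the coroot of `σ`. -/
inductive Descends (Sg : Set V) (l : V) : V → Prop
  | refl : Descends Sg l l
  | step {x σ : V} : Descends Sg l x → σ ∈ Sg → 0 < pairR x σ → Descends Sg l (reflV σ x)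

section Descends

variable {Sg : Set V} {l : V}

lemma Descends.pairR_int (hint : ∀ σ ∈ Sg, ∀ τ ∈ Sg, ∃ n : ℤ, pairR σ τ = n)
    (hl : ∀ τ ∈ Sg, ∃ n : ℤ, pairR l τ = n) {x : V} (hx : Descends Sg l x) :
    ∀ τ ∈ Sg, ∃ n : ℤ, pairR x τ = n := by
  induction hx with
  | refl => exact hl
  | @step x σ _ hσ _ ih =>
    intro τ hτ
    obtain ⟨m, hm⟩ := ih σ hσ
    obtain ⟨n, hn⟩ := ih τ hτ
    obtain ⟨k, hk⟩ := hint σ hσ τ hτ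
    exact ⟨n - m * k, by rw [reflV, pairR_sub, pairR_smul, hm, hn, hk]; push_cast; ring⟩

lemma Descends.functional_le {x : V} (hx : Descends Sg l x) (φ : V →ₗ[ℝ] ℝ)
    (hφ : ∀ σ ∈ Sg, 0 ≤ φ σ) : φ x ≤ φ l := by
  induction hx with
  | refl => exact le_rfl
  | @step x σ _ hσ hpos ih =>
    have := mul_nonneg hpos.le (hφ σ hσ)
    simp only [reflV, map_sub, map_smul, smul_eq_mul]
    linarith

lemma Descends.exists_depth (hint : ∀ σ ∈ Sg, ∀ τ ∈ Sg, ∃ n : ℤ, pairR σ τ = n)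
    (hl : ∀ τ ∈ Sg, ∃ n : ℤ, pairR l τ = n) {h : V →ₗ[ℝ] ℝ} (hh : ∀ σ ∈ Sg, h σ = 1)
    {x : V} (hx : Descends Sg l x) : ∃ n : ℕ, h x = h l - n := by
  induction hx with
  | refl => exact ⟨0, by simp⟩
  | @step x σ hx hσ hpos ih =>
    obtain ⟨n, hn⟩ := ih
    obtain ⟨k, hk⟩ := hx.pairR_int hint hl σ hσ
    lift k to ℕ using by rw [hk] at hpos; exact_mod_cast hpos.le
    refine ⟨n + k, ?_⟩
    simp only [reflV, map_sub, map_smul, hh σ hσ, hn, hk]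
    push_cast
    simp
    ring

/-- Rank-two case: a descendant that is dominant for `σ` and `τ` has all of its orbit under
`s_σ` and `s_τ` among the descendants. -/
lemma Descends.exists_stable_pair (hint : ∀ σ ∈ Sg, ∀ τ ∈ Sg, ∃ n : ℤ, pairR σ τ = n)
    (hl : ∀ τ ∈ Sg, ∃ n : ℤ, pairR l τ = n) {σ τ y : V} (hσ : σ ∈ Sg) (hτ : τ ∈ Sg)
    (hσ0 : σ ≠ 0) (hτ0 : τ ≠ 0)
    (hστ : pairR σ τ ≤ 0) (hτσ : pairR τ σ ≤ 0) (h4 : pairR σ τ * pairR τ σ < 4)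
    (hy : Descends Sg l y) (hyσ : 0 ≤ pairR y σ) (hyτ : 0 ≤ pairR y τ) :
    ∃ U : Set V, y ∈ U ∧ (∀ z ∈ U, Descends Sg l z) ∧
      (∀ z ∈ U, reflV σ z ∈ U) ∧ (∀ z ∈ U, reflV τ z ∈ U) := by
  obtain ⟨p, hp⟩ := hy.pairR_int hint hl σ hσ
  obtain ⟨q, hq⟩ := hy.pairR_int hint hl τ hτ
  obtain ⟨a, ha⟩ : ∃ a : ℤ, pairR σ τ = -a := by
    obtain ⟨n, hn⟩ := hint σ hσ τ hτ
    exact ⟨-n, by simp [hn]⟩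
  obtain ⟨b, hb⟩ : ∃ b : ℤ, pairR τ σ = -b := by
    obtain ⟨n, hn⟩ := hint τ hτ σ hσ
    exact ⟨-n, by simp [hn]⟩
  have hab0 : a = 0 ↔ b = 0 := by
    have : pairR σ τ = 0 ↔ pairR τ σ = 0 := by
      simp [pairR, hσ0, hτ0, real_inner_comm τ σ]
    rw [ha, hb] at this
    simpa using this
  have reflσ (u v : ℤ) : reflV σ (y - (u : ℝ) • σ - (v : ℝ) • τ) =
      y - ((p - u + b * v : ℤ) : ℝ) • σ - (v : ℝ) • τ := by
    simp only [reflV, pairR_sub, pairR_smul, pairR_self hσ0, hp, hb]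
    push_cast
    module
  have reflτ (u v : ℤ) : reflV τ (y - (u : ℝ) • σ - (v : ℝ) • τ) =
      y - (u : ℝ) • σ - ((q - v + a * u : ℤ) : ℝ) • τ := by
    simp only [reflV, pairR_sub, pairR_smul, pairR_self hτ0, hq, ha]
    push_cast
    module
  rw [ha] at hστ h4
  rw [hb] at hτσ h4
  rw [hp] at hyσ
  rw [hq] at hyτ
  obtain ⟨U, hU0, hUP, hUS, hUT⟩ := exists_stable (a := a) (b := b) (p := p) (q := q)
    (by exact_mod_cast hyσ) (by exact_mod_cast hyτ) (by simpa using hστ) (by simpa using hτσ)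
    (by rw [neg_mul_neg] at h4; exact_mod_cast h4) hab0
    (fun u v ↦ Descends Sg l (y - (u : ℝ) • σ - (v : ℝ) • τ)) (by simpa using hy)
    (by
      rintro u v _ hd rfl hle
      rcases hle.eq_or_lt with h | h
      · rwa [← h]
      · rw [← reflσ]
        refine hd.step hσ ?_
        simp only [pairR_sub, pairR_smul, pairR_self hσ0, hp, hb]
        have : (u : ℝ) < p - u + b * v := by exact_mod_cast h
        linarith)
    (by
      rintro u v _ hd rfl hle
      rcases hle.eq_or_lt with h | h
      · rwa [← h]
      · rw [← reflτ]
        refine hd.step hτ ?_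
        simp only [pairR_sub, pairR_smul, pairR_self hτ0, hq, ha]
        have : (v : ℝ) < q - v + a * u := by exact_mod_cast h
        linarith)
  refine ⟨{z | ∃ u v : ℤ, U u v ∧ z = y - (u : ℝ) • σ - (v : ℝ) • τ}, ⟨0, 0, hU0, by simp⟩, ?_, ?_,
    ?_⟩
  · rintro _ ⟨u, v, huv, rfl⟩
    exact hUP u v huv
  · rintro _ ⟨u, v, huv, rfl⟩
    exact ⟨_, _, hUS u v huv, reflσ u v⟩
  · rintro _ ⟨u, v, huv, rfl⟩
    exact ⟨_, _, hUT u v huv, reflτ u v⟩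

/-- The descendants of a dominant integral weight are stable under the reflections in `Sg`. -/
lemma Descends.reflV_mem (hne : ∀ σ ∈ Sg, σ ≠ 0)
    (hint : ∀ σ ∈ Sg, ∀ τ ∈ Sg, ∃ n : ℤ, pairR σ τ = n)
    (hnonpos : ∀ σ ∈ Sg, ∀ τ ∈ Sg, σ ≠ τ → pairR σ τ ≤ 0)
    (h4 : ∀ σ ∈ Sg, ∀ τ ∈ Sg, σ ≠ τ → pairR σ τ * pairR τ σ < 4)
    {h : V →ₗ[ℝ] ℝ} (hh : ∀ σ ∈ Sg, h σ = 1)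
    (hl : ∀ τ ∈ Sg, ∃ n : ℤ, pairR l τ = n) (hdom : ∀ τ ∈ Sg, 0 ≤ pairR l τ)
    {x σ : V} (hx : Descends Sg l x) (hσ : σ ∈ Sg) : Descends Sg l (reflV σ x) := by
  obtain ⟨n, hn⟩ := hx.exists_depth hint hl hh
  induction n using Nat.strong_induction_on generalizing x σ with
  | _ n ih =>
  rcases lt_trichotomy (pairR x σ) 0 with hneg | hzero | hpos
  rotate_left
  · simpa [reflV, hzero] using hx
  · exact hx.step hσ hpos
  cases hx with
  | refl => exact absurd (hdom σ hσ) hneg.not_ge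
  | @step y τ hy hτ hyτ =>
  by_cases hστ : σ = τ
  · subst hστ
    rwa [reflV_reflV (hne σ hσ)]
  obtain ⟨m, hm⟩ := hy.exists_depth hint hl hh
  have hmn : m < n := by
    simp only [reflV, map_sub, map_smul, hh τ hτ, hm, smul_eq_mul, mul_one] at hn
    have : (m : ℝ) < n := by linarith
    exact_mod_cast this
  -- Ascend from `y`, by `s_σ` and `s_τ`, to a descendant `z` of minimal depth.
  classical
  let Q : ℕ → Prop := fun k ↦ ∃ z, Descends Sg l z ∧ h z = h l - k ∧ ∀ U : Set V,
    (∀ w ∈ U, reflV σ w ∈ U) → (∀ w ∈ U, reflV τ w ∈ U) → z ∈ U → y ∈ U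
  have hQ : ∃ k, Q k := ⟨m, y, hy, hm, fun _ _ _ hU ↦ hU⟩
  have hkm : Nat.find hQ ≤ m := Nat.find_min' hQ ⟨y, hy, hm, fun _ _ _ hU ↦ hU⟩
  obtain ⟨z, hz, hzk, hzy⟩ := Nat.find_spec hQ
  have dominant (ρ : V) (hρ : ρ ∈ Sg) (hρστ : ρ = σ ∨ ρ = τ) : 0 ≤ pairR z ρ := by
    by_contra! hlt
    have hd := ih _ (hkm.trans_lt hmn) hz hρ hzk
    obtain ⟨j, hj⟩ := hd.exists_depth hint hl hh
    refine Nat.find_min hQ (m := j) ?_ ⟨_, hd, hj, fun U hUσ hUτ hU ↦ hzy U hUσ hUτ ?_⟩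
    · simp only [reflV, map_sub, map_smul, hh ρ hρ, hzk, smul_eq_mul, mul_one] at hj
      have : (j : ℝ) < Nat.find hQ := by linarith
      exact_mod_cast this
    · rw [← reflV_reflV (hne ρ hρ) z]
      rcases hρστ with rfl | rfl
      · exact hUσ _ hU
      · exact hUτ _ hU
  obtain ⟨U, hzU, hUD, hUσ, hUτ⟩ := hz.exists_stable_pair hint hl hσ hτ (hne σ hσ) (hne τ hτ)
    (hnonpos σ hσ τ hτ hστ) (hnonpos τ hτ σ hσ (Ne.symm hστ)) (h4 σ hσ τ hτ hστ)
    (dominant σ hσ (Or.inl rfl)) (dominant τ hτ (Or.inr rfl))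
  exact hUD _ (hUσ _ (hUτ _ (hzy U hUσ hUτ hzU)))

end Descends

section WeylGroup

variable {Sg : Set V}

lemma reflEquiv_mem_WGroup {σ : V} (hσ : σ ∈ Sg) (hσ0 : σ ≠ 0) : reflEquiv hσ0 ∈ WGroup Sg :=
  Subgroup.subset_closure ⟨σ, hσ, reflEquiv_apply hσ0⟩

lemma WGroup_mem_of_stable (hne : ∀ σ ∈ Sg, σ ≠ 0) {U : Set V}
    (hU : ∀ σ ∈ Sg, ∀ x ∈ U, reflV σ x ∈ U) {w : V ≃ₗ[ℝ] V} (hw : w ∈ WGroup Sg) {x : V}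
    (hx : x ∈ U) : w x ∈ U := by
  have key : ∀ x, w x ∈ U ↔ x ∈ U := by
    induction hw using Subgroup.closure_induction with
    | mem w hw =>
      obtain ⟨σ, hσ, hw⟩ := hw
      intro x
      rw [hw]
      exact ⟨fun h ↦ reflV_reflV (hne σ hσ) x ▸ hU σ hσ _ h, hU σ hσ x⟩
    | one => exact fun x ↦ Iff.rfl
    | mul w₁ w₂ _ _ h₁ h₂ => exact fun x ↦ (h₁ (w₂ x)).trans (h₂ x)
    | inv w _ h =>
      intro x
      rw [← h (w⁻¹ x), ← LinearEquiv.mul_apply, mul_inv_cancel, LinearEquiv.coe_one, id]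
  exact (key x).mpr hx

lemma WGroup_inner (hne : ∀ σ ∈ Sg, σ ≠ 0) {w : V ≃ₗ[ℝ] V} (hw : w ∈ WGroup Sg) (x y : V) :
    ⟪w x, w y⟫ = ⟪x, y⟫ := by
  induction hw using Subgroup.closure_induction generalizing x y with
  | mem w hw =>
    obtain ⟨σ, hσ, hw⟩ := hw
    rw [hw, hw, inner_reflV_reflV (hne σ hσ)]
  | one => rfl
  | mul w₁ w₂ _ _ h₁ h₂ => rw [LinearEquiv.mul_apply, LinearEquiv.mul_apply, h₁, h₂]
  | inv w _ h =>
    rw [← h, ← LinearEquiv.mul_apply, ← LinearEquiv.mul_apply, mul_inv_cancel]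
    rfl

lemma WGroup_pairR (hne : ∀ σ ∈ Sg, σ ≠ 0) {w : V ≃ₗ[ℝ] V} (hw : w ∈ WGroup Sg) (x y : V) :
    pairR (w x) (w y) = pairR x y := by
  simp only [pairR, WGroup_inner hne hw]

lemma reflV_WGroup_apply (hne : ∀ σ ∈ Sg, σ ≠ 0) {w : V ≃ₗ[ℝ] V} (hw : w ∈ WGroup Sg) {σ : V}
    (hσ : σ ∈ Sg) (x : V) :
    reflV (w σ) x = (w * reflEquiv (hne σ hσ) * w⁻¹) x := by
  have hx : x = w (w⁻¹ x) := by
    rw [← LinearEquiv.mul_apply, mul_inv_cancel, LinearEquiv.coe_one, id]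
  rw [LinearEquiv.mul_apply, LinearEquiv.mul_apply, reflEquiv_apply, reflV, reflV, map_sub,
    map_smul, ← hx]
  congr 2
  nth_rw 1 [hx]
  rw [WGroup_pairR hne hw]

lemma subset_WOrbit : Sg ⊆ WOrbit Sg := fun σ hσ ↦ ⟨1, one_mem _, σ, hσ, rfl⟩

lemma WOrbit_WGroup_apply {w : V ≃ₗ[ℝ] V} (hw : w ∈ WGroup Sg) {x : V} (hx : x ∈ WOrbit Sg) :
    w x ∈ WOrbit Sg := by
  obtain ⟨w', hw', σ, hσ, rfl⟩ := hx
  exact ⟨w * w', mul_mem hw hw', σ, hσ, rfl⟩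

lemma reflV_mem_of_mem_WOrbit (hne : ∀ σ ∈ Sg, σ ≠ 0) {α : V} (hα : α ∈ WOrbit Sg) {U : Set V}
    (hU : ∀ w ∈ WGroup Sg, ∀ x ∈ U, w x ∈ U) {x : V} (hx : x ∈ U) : reflV α x ∈ U := by
  obtain ⟨w, hw, σ, hσ, rfl⟩ := hα
  rw [reflV_WGroup_apply hne hw hσ]
  exact hU _ (mul_mem (mul_mem hw (reflEquiv_mem_WGroup hσ _)) (inv_mem hw)) x hx

lemma pairR_int_of_mem_span (hint : ∀ σ ∈ Sg, ∀ τ ∈ Sg, ∃ n : ℤ, pairR σ τ = n) {τ : V}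
    (hτ : τ ∈ Sg) {x : V} (hx : x ∈ Submodule.span ℤ Sg) : ∃ n : ℤ, pairR x τ = n := by
  induction hx using Submodule.span_induction with
  | mem x hx => exact hint x hx τ hτ
  | zero => exact ⟨0, by simp [pairR]⟩
  | add x y _ _ hx hy =>
    obtain ⟨m, hm⟩ := hx
    obtain ⟨n, hn⟩ := hy
    exact ⟨m + n, by rw [pairR_add, hm, hn]; push_cast; rfl⟩
  | smul c x _ hx =>
    obtain ⟨m, hm⟩ := hx
    exact ⟨c * m, by rw [← Int.cast_smul_eq_zsmul ℝ, pairR_smul, hm]; push_cast; rfl⟩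

lemma WGroup_mem_span (hne : ∀ σ ∈ Sg, σ ≠ 0)
    (hint : ∀ σ ∈ Sg, ∀ τ ∈ Sg, ∃ n : ℤ, pairR σ τ = n) {w : V ≃ₗ[ℝ] V} (hw : w ∈ WGroup Sg)
    {x : V} (hx : x ∈ Submodule.span ℤ Sg) : w x ∈ Submodule.span ℤ Sg := by
  refine WGroup_mem_of_stable (U := (Submodule.span ℤ Sg : Set V)) hne (fun σ hσ y hy ↦ ?_) hw hx
  obtain ⟨n, hn⟩ := pairR_int_of_mem_span hint hσ hy
  rw [reflV, hn, Int.cast_smul_eq_zsmul]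
  exact sub_mem hy (Submodule.smul_mem _ _ (Submodule.subset_span hσ))

lemma WOrbit_subset_span (hne : ∀ σ ∈ Sg, σ ≠ 0)
    (hint : ∀ σ ∈ Sg, ∀ τ ∈ Sg, ∃ n : ℤ, pairR σ τ = n) :
    WOrbit Sg ⊆ (Submodule.span ℤ Sg : Set V) := by
  rintro _ ⟨w, hw, σ, hσ, rfl⟩
  exact WGroup_mem_span hne hint hw (Submodule.subset_span hσ)

lemma ne_zero_of_mem_WOrbit (hne : ∀ σ ∈ Sg, σ ≠ 0) {α : V} (hα : α ∈ WOrbit Sg) : α ≠ 0 := by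
  obtain ⟨w, _, σ, hσ, rfl⟩ := hα
  exact w.map_ne_zero_iff.mpr (hne σ hσ)

end WeylGroup

section Functionals

variable {Sg : Set V}

lemma linearIndependent_of_pairR_nonpos (hne : ∀ σ ∈ Sg, σ ≠ 0)
    (hhalf : ∃ f : V →ₗ[ℝ] ℝ, ∀ σ ∈ Sg, 0 < f σ)
    (hnonpos : ∀ σ ∈ Sg, ∀ τ ∈ Sg, σ ≠ τ → pairR σ τ ≤ 0) :
    LinearIndependent ℝ ((↑) : Sg → V) := by
  obtain ⟨f, hf⟩ := hhalf
  refine LinearMap.BilinForm.linearIndependent_of_pairwise_le_zero (innerₗ V) ?_ f _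
    (fun i ↦ hf i i.2) fun i j hij ↦ ?_
  · intro x hx
    exact real_inner_self_pos.mpr hx
  · have h := hnonpos i i.2 j j.2 (Subtype.coe_injective.ne hij)
    have hpos : 0 < ⟪(j : V), (j : V)⟫ := real_inner_self_pos.mpr (hne j j.2)
    rw [pairR, div_le_iff₀ hpos] at h
    simp only [innerₗ_apply_apply]
    linarith

lemma LinearIndependent.exists_functional (hli : LinearIndependent ℝ ((↑) : Sg → V)) (g : V → ℝ) :
    ∃ φ : V →ₗ[ℝ] ℝ, ∀ σ ∈ Sg, φ σ = g σ := by
  have hli' : LinearIndepOn ℝ id Sg := hli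
  refine ⟨(Module.Basis.extend hli').constr ℝ fun i ↦ g i, fun σ hσ ↦ ?_⟩
  have := (Module.Basis.extend hli').constr_basis ℝ (fun i ↦ g i)
    ⟨σ, hli'.subset_extend (Set.subset_univ _) hσ⟩
  simpa using this

lemma pairR_mul_pairR_lt_four (hli : LinearIndependent ℝ ((↑) : Sg → V))
    {σ τ : V} (hσ : σ ∈ Sg) (hτ : τ ∈ Sg) (hσ0 : σ ≠ 0) (hτ0 : τ ≠ 0) (hστ : σ ≠ τ) :
    pairR σ τ * pairR τ σ < 4 := by
  classical
  obtain ⟨φ, hφ⟩ := hli.exists_functional (fun v ↦ if v = σ then 1 else 0)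
  have hz : (2 : ℝ) • σ - pairR σ τ • τ ≠ 0 := by
    intro h
    have := congrArg φ h
    simp [hφ σ hσ, hφ τ hτ, hστ.symm] at this
  have hσσ : 0 < ⟪σ, σ⟫ := real_inner_self_pos.mpr hσ0
  have hττ : 0 < ⟪τ, τ⟫ := real_inner_self_pos.mpr hτ0
  have h := real_inner_self_pos.mpr hz
  have key : ⟪(2 : ℝ) • σ - pairR σ τ • τ, (2 : ℝ) • σ - pairR σ τ • τ⟫ =
      (4 - pairR σ τ * pairR τ σ) * ⟪σ, σ⟫ := by
    simp only [pairR, inner_sub_left, inner_sub_right, real_inner_smul_left,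
      real_inner_smul_right, real_inner_comm τ σ]
    field_simp
    ring
  rw [key] at h
  linarith [pos_of_mul_pos_left h hσσ.le]

lemma functional_int_of_mem_span {φ : V →ₗ[ℝ] ℝ} (hφ : ∀ σ ∈ Sg, ∃ n : ℤ, φ σ = n) {x : V}
    (hx : x ∈ Submodule.span ℤ Sg) : ∃ n : ℤ, φ x = n := by
  induction hx using Submodule.span_induction with
  | mem x hx => exact hφ x hx
  | zero => exact ⟨0, by simp⟩
  | add x y _ _ hx hy =>
    obtain ⟨m, hm⟩ := hx
    obtain ⟨n, hn⟩ := hy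
    exact ⟨m + n, by rw [map_add, hm, hn]; push_cast; rfl⟩
  | smul c x _ hx =>
    obtain ⟨m, hm⟩ := hx
    exact ⟨c * m, by rw [map_zsmul, hm, zsmul_eq_mul]; push_cast; rfl⟩

lemma finite_inter_span_of_isBounded [FiniteDimensional ℝ V]
    (hli : LinearIndependent ℝ ((↑) : Sg → V)) {s : Set V} (hs : Bornology.IsBounded s) :
    (s ∩ (Submodule.span ℤ Sg : Set V)).Finite := by
  have hli' : LinearIndepOn ℝ id Sg := hli
  let b := Module.Basis.extend hli'
  have : Finite (hli'.extend (Set.subset_univ Sg)) := Module.Finite.finite_basis b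
  refine (ZSpan.setFinite_inter b hs).subset (Set.inter_subset_inter_right _ ?_)
  refine Submodule.span_mono ?_
  rw [Module.Basis.range_extend]
  exact hli'.subset_extend _

lemma WOrbit_finite [FiniteDimensional ℝ V] (hfin : Sg.Finite) (hne : ∀ σ ∈ Sg, σ ≠ 0)
    (hint : ∀ σ ∈ Sg, ∀ τ ∈ Sg, ∃ n : ℤ, pairR σ τ = n)
    (hli : LinearIndependent ℝ ((↑) : Sg → V)) : (WOrbit Sg).Finite := by
  obtain ⟨C, hC⟩ := hfin.isBounded.exists_norm_le
  refine (finite_inter_span_of_isBounded hli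
    (Metric.isBounded_closedBall (x := (0 : V)) (r := C))).subset
    (Set.subset_inter ?_ (WOrbit_subset_span hne hint))
  rintro _ ⟨w, hw, σ, hσ, rfl⟩
  have : ‖w σ‖ = ‖σ‖ := by
    rw [norm_eq_sqrt_real_inner, WGroup_inner hne hw, ← norm_eq_sqrt_real_inner]
  rw [mem_closedBall_zero_iff, this]
  exact hC σ hσ

end Functionals

/-- If some coordinate of a root is positive, then all of its coordinates are nonnegative. -/
lemma WOrbit_coord_nonneg [FiniteDimensional ℝ V] {Sg : Set V} (hne : ∀ σ ∈ Sg, σ ≠ 0)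
    (hint : ∀ σ ∈ Sg, ∀ τ ∈ Sg, ∃ n : ℤ, pairR σ τ = n)
    (hnonpos : ∀ σ ∈ Sg, ∀ τ ∈ Sg, σ ≠ τ → pairR σ τ ≤ 0)
    (hli : LinearIndependent ℝ ((↑) : Sg → V)) {α σ : V} (hα : α ∈ WOrbit Sg) (hσ : σ ∈ Sg)
    {φ : V →ₗ[ℝ] ℝ} (hφσ : φ σ = 1) (hφ : ∀ τ ∈ Sg, τ ≠ σ → φ τ = 0) (hφα : 0 < φ α)
    {ψ : V →ₗ[ℝ] ℝ} (hψ : ∀ τ ∈ Sg, 0 ≤ ψ τ) : 0 ≤ ψ α := by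
  obtain ⟨h, hh⟩ := hli.exists_functional fun _ ↦ 1
  -- `l` is the fundamental weight attached to `σ`.
  obtain ⟨l, hl⟩ : ∃ l : V, ∀ x, ⟪l, x⟫ = ⟪σ, σ⟫ / 2 * φ x :=
    ⟨(⟪σ, σ⟫ / 2) • (InnerProductSpace.toDual ℝ V).symm (LinearMap.toContinuousLinearMap φ),
      fun x ↦ by simp [real_inner_smul_left]⟩
  have hσσ : 0 < ⟪σ, σ⟫ := real_inner_self_pos.mpr (hne σ hσ)
  have hlσ : pairR l σ = 1 := by
    rw [pairR, hl, hφσ]; field_simp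
  have hlτ : ∀ τ ∈ Sg, τ ≠ σ → pairR l τ = 0 := fun τ hτ hτσ ↦ by
    rw [pairR, hl, hφ τ hτ hτσ]; simp
  have hlint : ∀ τ ∈ Sg, ∃ n : ℤ, pairR l τ = n := fun τ hτ ↦ by
    by_cases hτσ : τ = σ
    · exact ⟨1, by simp [hτσ, hlσ]⟩
    · exact ⟨0, by simp [hlτ τ hτ hτσ]⟩
  have hldom : ∀ τ ∈ Sg, 0 ≤ pairR l τ := fun τ hτ ↦ by
    by_cases hτσ : τ = σ
    · simp [hτσ, hlσ]
    · simp [hlτ τ hτ hτσ]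
  have hdesc : Descends Sg l (reflV α l) := by
    refine reflV_mem_of_mem_WOrbit (U := {x | Descends Sg l x}) hne hα
      (fun w hw x hx ↦ WGroup_mem_of_stable hne (fun τ hτ y hy ↦ ?_) hw hx) Descends.refl
    exact Descends.reflV_mem hne hint hnonpos
      (fun ρ hρ τ hτ hρτ ↦ pairR_mul_pairR_lt_four hli hρ hτ (hne ρ hρ) (hne τ hτ) hρτ)
      hh hlint hldom hy hτ
  have hle := hdesc.functional_le ψ hψ
  have hpair : 0 < pairR l α := by
    rw [pairR, hl]
    have := real_inner_self_pos.mpr (ne_zero_of_mem_WOrbit hne hα)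
    positivity
  simp only [reflV, map_sub, map_smul, smul_eq_mul] at hle
  exact nonneg_of_mul_nonneg_right (by linarith) hpair

lemma WOrbit_reduced {Sg : Set V} (hne : ∀ σ ∈ Sg, σ ≠ 0)
    (hint : ∀ σ ∈ Sg, ∀ τ ∈ Sg, ∃ n : ℤ, pairR σ τ = n)
    (hli : LinearIndependent ℝ ((↑) : Sg → V)) {α : V} (hα : α ∈ WOrbit Sg) {c : ℝ}
    (hc : c • α ∈ WOrbit Sg) : c • α = α ∨ c • α = -α := by
  classical
  have hc0 : c ≠ 0 := fun h ↦ ne_zero_of_mem_WOrbit hne hc (by simp [h])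
  -- A multiple of a simple root in the lattice is an integral multiple.
  have key : ∀ w ∈ WGroup Sg, ∀ σ ∈ Sg, ∀ d : ℝ, d • w σ ∈ WOrbit Sg → ∃ n : ℤ, d = n := by
    intro w hw σ hσ d hd
    obtain ⟨φ, hφ⟩ := hli.exists_functional (fun v ↦ if v = σ then 1 else 0)
    have hmem : d • σ ∈ Submodule.span ℤ Sg := by
      have := WOrbit_subset_span hne hint (WOrbit_WGroup_apply (inv_mem hw) hd)
      rwa [map_smul, ← LinearEquiv.mul_apply, inv_mul_cancel, LinearEquiv.coe_one, id] at this
    obtain ⟨n, hn⟩ := functional_int_of_mem_span (φ := φ) (fun τ hτ ↦ by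
      rw [hφ τ hτ]
      split_ifs
      exacts [⟨1, by simp⟩, ⟨0, by simp⟩]) hmem
    exact ⟨n, by simpa [hφ σ hσ] using hn⟩
  obtain ⟨m, hm⟩ : ∃ m : ℤ, c = m := by
    obtain ⟨w, hw, σ, hσ, rfl⟩ := hα
    exact key w hw σ hσ c hc
  obtain ⟨n, hn⟩ : ∃ n : ℤ, c⁻¹ = n := by
    obtain ⟨w, hw, σ, hσ, hcα⟩ := hc
    refine key w hw σ hσ c⁻¹ ?_
    rwa [← hcα, inv_smul_smul₀ hc0]
  have hmn : m * n = 1 := by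
    have : c * c⁻¹ = 1 := mul_inv_cancel₀ hc0
    rw [hm] at this
    rw [hm] at hn
    rw [hn] at this
    exact_mod_cast this
  rcases Int.eq_one_or_neg_one_of_mul_eq_one hmn with rfl | rfl
  · left; simp [hm]
  · right; simp [hm]

lemma WOrbit_isBase [FiniteDimensional ℝ V] {Sg : Set V} (hne : ∀ σ ∈ Sg, σ ≠ 0)
    (hint : ∀ σ ∈ Sg, ∀ τ ∈ Sg, ∃ n : ℤ, pairR σ τ = n)
    (hnonpos : ∀ σ ∈ Sg, ∀ τ ∈ Sg, σ ≠ τ → pairR σ τ ≤ 0)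
    (hli : LinearIndependent ℝ ((↑) : Sg → V)) : IsBase (WOrbit Sg) Sg := by
  classical
  have hZ := WOrbit_subset_span hne hint
  refine ⟨subset_WOrbit, hli, le_antisymm (Submodule.span_mono subset_WOrbit)
    (Submodule.span_le.mpr fun α hα ↦ Submodule.span_subset_span ℤ ℝ Sg (hZ hα)), fun α hα ↦ ?_⟩
  obtain ⟨c, hcs, hc⟩ := Submodule.mem_span_set.mp (hZ hα)
  have hcα : α = c.sum fun v n ↦ (n : ℝ) • v := by
    simp only [← hc, Int.cast_smul_eq_zsmul]
  refine ⟨c, hcs, hcα, ?_⟩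
  choose φ hφ using fun σ : V ↦ hli.exists_functional (fun v ↦ if v = σ then 1 else 0)
  have hcoord : ∀ σ, φ σ α = c σ := fun σ ↦ by
    rw [hcα, Finsupp.sum, map_sum]
    rw [Finset.sum_congr rfl fun v hv ↦ by rw [map_smul, hφ σ v (hcs hv)]]
    simp +contextual
  by_cases hpos : ∃ σ, 0 < c σ
  · left
    obtain ⟨σ, hσ⟩ := hpos
    have hσS : σ ∈ Sg := hcs (Finsupp.mem_support_iff.mpr hσ.ne')
    intro τ
    have : (0 : ℝ) ≤ φ τ α := WOrbit_coord_nonneg hne hint hnonpos hli hα hσS (φ := φ σ)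
      (by simp [hφ σ σ hσS]) (fun ρ hρ hρσ ↦ by simp [hφ σ ρ hρ, hρσ])
      (by rw [hcoord]; exact_mod_cast hσ)
      (fun ρ hρ ↦ by rw [hφ τ ρ hρ]; split_ifs <;> simp)
    rw [hcoord] at this
    exact_mod_cast this
  · right
    simpa using hpos

/-- a finite set `Σ` of nonzero vectors lying in an open half-space, with
nonpositive integral mutual Cartan numbers, is linearly independent and is the base of
a finite reduced crystallographic root system, namely `Φ = W·Σ`, which is contained in
the ℤ-span (hence the span) of `Σ`. -/
theorem stmt0 {V : Type*} [NormedAddCommGroup V] [InnerProductSpace ℝ V]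
    [FiniteDimensional ℝ V] (Sg : Set V) (hfin : Sg.Finite)
    (hne : ∀ σ ∈ Sg, σ ≠ 0)
    (hhalf : ∃ f : V →ₗ[ℝ] ℝ, ∀ σ ∈ Sg, 0 < f σ)
    (hint : ∀ σ ∈ Sg, ∀ τ ∈ Sg, σ ≠ τ → ∃ n : ℤ, n ≤ 0 ∧ pairR σ τ = (n : ℝ)) :
    LinearIndependent ℝ ((↑) : Sg → V) ∧
    IsRootSystem (WOrbit Sg) ∧
    WOrbit Sg ⊆ (Submodule.span ℤ Sg : Set V) ∧
    IsBase (WOrbit Sg) Sg := by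
  have hint' : ∀ σ ∈ Sg, ∀ τ ∈ Sg, ∃ n : ℤ, pairR σ τ = n := fun σ hσ τ hτ ↦ by
    by_cases h : σ = τ
    · exact ⟨2, by rw [h, pairR_self (hne τ hτ)]; norm_num⟩
    · obtain ⟨n, _, hn⟩ := hint σ hσ τ hτ h
      exact ⟨n, hn⟩
  have hnonpos : ∀ σ ∈ Sg, ∀ τ ∈ Sg, σ ≠ τ → pairR σ τ ≤ 0 := fun σ hσ τ hτ h ↦ by
    obtain ⟨n, hn0, hn⟩ := hint σ hσ τ hτ h
    rw [hn]
    exact_mod_cast hn0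
  have hli := linearIndependent_of_pairR_nonpos hne hhalf hnonpos
  have hZ := WOrbit_subset_span hne hint'
  refine ⟨hli, ⟨WOrbit_finite hfin hne hint' hli, fun h ↦ ne_zero_of_mem_WOrbit hne h rfl,
    fun α hα β hβ ↦ reflV_mem_of_mem_WOrbit hne hα (fun w hw x hx ↦ WOrbit_WGroup_apply hw hx) hβ,
    ?_, fun α hα c hc ↦ WOrbit_reduced hne hint' hli hα hc⟩, hZ,
    WOrbit_isBase hne hint' hnonpos hli⟩
  rintro _ ⟨w, hw, σ, hσ, rfl⟩ β hβ
  obtain ⟨n, hn⟩ := pairR_int_of_mem_span hint' hσ (hZ (WOrbit_WGroup_apply (inv_mem hw) hβ))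
  have hβw : w (w⁻¹ β) = β := w.apply_symm_apply β
  exact ⟨n, by rw [← hn, ← WGroup_pairR hne hw (w⁻¹ β), hβw]⟩
end

section
/- Let Φ be a finite reduced crystallographic root system in a finite-dimensional real inner product space, let Ψ ⊆ Φ be a root subsystem, and let Σ be a base of Ψ. Then Ψ is additively closed in Φ if and only if for all σ, τ ∈ Σ the root subsystem Ψ ∩ (ℝσ + ℝτ) is additively closed in Φ. -/
open RealInnerProductSpace

variable {V : Type*} [NormedAddCommGroup V] [InnerProductSpace ℝ V]

lemma pairR_sub_smul_self {v : V} (hv : v ≠ 0) (x : V) (r : ℝ) :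
    pairR (x - r • v) v = pairR x v - 2 * r := by
  have : ⟪v, v⟫ ≠ 0 := inner_self_ne_zero.mpr hv
  unfold pairR
  rw [inner_sub_left, real_inner_smul_left]
  field_simp

lemma reflV_self {v : V} (hv : v ≠ 0) : reflV v v = -v := by
  rw [reflV, pairR_self hv, two_smul]
  abel

lemma IsRootSystem.ne_zero {Φ : Set V} (hΦ : IsRootSystem Φ) {α : V} (hα : α ∈ Φ) : α ≠ 0 :=
  fun h => hΦ.2.1 (h ▸ hα)

lemma IsRootSystem.neg_mem {Φ : Set V} (hΦ : IsRootSystem Φ) {α : V} (hα : α ∈ Φ) : -α ∈ Φ :=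
  reflV_self (hΦ.ne_zero hα) ▸ hΦ.2.2.1 α hα α hα

lemma IsRootSubsystem.isRootSystem {Φ Ψ : Set V} (hΦ : IsRootSystem Φ)
    (hΨ : IsRootSubsystem Φ Ψ) : IsRootSystem Ψ :=
  ⟨hΦ.1.subset hΨ.1, fun h => hΦ.2.1 (hΨ.1 h), hΨ.2.2,
    fun α hα β hβ => hΦ.2.2.2.1 α (hΨ.1 hα) β (hΨ.1 hβ),
    fun α hα c hc => hΦ.2.2.2.2 α (hΨ.1 hα) c (hΨ.1 hc)⟩

/-- Two distinct roots at an acute angle differ by a root. -/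
lemma IsRootSystem.sub_mem {Φ : Set V} (hΦ : IsRootSystem Φ) {α β : V} (hα : α ∈ Φ)
    (hβ : β ∈ Φ) (hne : α ≠ β) (hpos : 0 < ⟪α, β⟫) : α - β ∈ Φ := by
  have ha := hΦ.ne_zero hα
  have hb := hΦ.ne_zero hβ
  have haa : 0 < ⟪α, α⟫ := real_inner_self_pos.mpr ha
  have hbb : 0 < ⟪β, β⟫ := real_inner_self_pos.mpr hb
  obtain ⟨m, hm⟩ := hΦ.2.2.2.1 β hβ α hα
  obtain ⟨n, hn⟩ := hΦ.2.2.2.1 α hα β hβ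
  have hm' : (m : ℝ) * ⟪β, β⟫ = 2 * ⟪α, β⟫ := by
    rw [← hm, pairR]; field_simp
  have hn' : (n : ℝ) * ⟪α, α⟫ = 2 * ⟪α, β⟫ := by
    rw [← hn, pairR, real_inner_comm]; field_simp
  have hm0 : (0 : ℝ) < m := pos_of_mul_pos_left (by rw [hm']; positivity) hbb.le
  have hn0 : (0 : ℝ) < n := pos_of_mul_pos_left (by rw [hn']; positivity) haa.le
  have hm1 : 1 ≤ m := by exact_mod_cast hm0
  have hn1 : 1 ≤ n := by exact_mod_cast hn0
  by_cases h1 : m = 1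
  · have := hΦ.2.2.1 β hβ α hα
    rwa [reflV, hm, h1, Int.cast_one, one_smul] at this
  by_cases h2 : n = 1
  · have := hΦ.neg_mem (hΦ.2.2.1 α hα β hβ)
    rwa [reflV, hn, h2, Int.cast_one, one_smul, neg_sub] at this
  exfalso
  have hm2 : (2 : ℝ) ≤ m := by exact_mod_cast (by omega : 2 ≤ m)
  have hn2 : (2 : ℝ) ≤ n := by exact_mod_cast (by omega : 2 ≤ n)
  have hdiff : ⟪α - β, α - β⟫ ≤ 0 := by
    rw [real_inner_sub_sub_self]
    nlinarith
  exact hne (sub_eq_zero.mp (real_inner_self_nonpos.mp hdiff))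

section Combinations

variable {ι : Type*} [Fintype ι]

/-- The integral linear combination of the family `b` with coefficients `c`. -/
noncomputable def intComb (b : ι → V) (c : ι → ℤ) : V := ∑ i, (c i : ℝ) • b i

lemma intComb_sub (b : ι → V) (c d : ι → ℤ) :
    intComb b (c - d) = intComb b c - intComb b d := by
  simp [intComb, sub_smul, Finset.sum_sub_distrib]

lemma intComb_neg (b : ι → V) (c : ι → ℤ) : intComb b (-c) = -intComb b c := by
  simp [intComb]

lemma intComb_single [DecidableEq ι] (b : ι → V) (i : ι) (k : ℤ) :
    intComb b (Pi.single i k) = (k : ℝ) • b i := by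
  unfold intComb
  rw [Finset.sum_eq_single i]
  · simp
  · intro j _ hj
    simp [Pi.single_eq_of_ne hj]
  · simp

lemma intComb_injective {b : ι → V} (hb : LinearIndependent ℝ b) :
    Function.Injective (intComb b) := by
  intro c d h
  funext i
  have := Fintype.linearIndependent_iff.mp hb (fun i => (c i : ℝ) - d i)
    (by simpa [intComb, sub_smul, Finset.sum_sub_distrib, sub_eq_zero] using h) i
  exact_mod_cast sub_eq_zero.mp this

lemma inner_intComb_right (b : ι → V) (c : ι → ℤ) (x : V) :
    ⟪x, intComb b c⟫ = ∑ i, (c i : ℝ) * ⟪x, b i⟫ := by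
  simp [intComb, inner_sum, real_inner_smul_right]

lemma inner_intComb_left (b : ι → V) (c : ι → ℤ) (x : V) :
    ⟪intComb b c, x⟫ = ∑ i, (c i : ℝ) * ⟪b i, x⟫ := by
  simp [intComb, sum_inner, real_inner_smul_left]

/-- The sum of the absolute values of the coefficients. -/
def coeffHeight (c : ι → ℤ) : ℕ := ∑ i, (c i).natAbs

lemma coeffHeight_neg (c : ι → ℤ) : coeffHeight (-c) = coeffHeight c := by
  simp [coeffHeight]

lemma coeffHeight_sub_single [DecidableEq ι] (c : ι → ℤ) (i : ι) (k : ℤ) :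
    coeffHeight (c - Pi.single i k) + (c i).natAbs = coeffHeight c + (c i - k).natAbs := by
  unfold coeffHeight
  rw [← Finset.add_sum_erase _ _ (Finset.mem_univ i),
    ← Finset.add_sum_erase (f := fun j => (c j).natAbs) _ (Finset.mem_univ i)]
  have : ∑ j ∈ Finset.univ.erase i, ((c - Pi.single i k : ι → ℤ) j).natAbs
      = ∑ j ∈ Finset.univ.erase i, (c j).natAbs := by
    refine Finset.sum_congr rfl fun j hj => ?_
    simp [Pi.single_eq_of_ne (Finset.ne_of_mem_erase hj)]
  rw [this]
  simp only [Pi.sub_apply, Pi.single_eq_same]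
  omega

/-- For an obtuse independent family, a combination with a positive coefficient makes an acute
angle with some member of the family occurring with positive coefficient. -/
lemma exists_coeff_pos_inner_pos {b : ι → V} (hb : LinearIndependent ℝ b)
    (hobt : ∀ i j, i ≠ j → ⟪b i, b j⟫ ≤ 0) {c : ι → ℤ} (hc : ∃ i, 0 < c i) :
    ∃ i, 0 < c i ∧ 0 < ⟪intComb b c, b i⟫ := by
  by_contra! hcon
  set p : ι → ℤ := fun i => max (c i) 0 with hp
  set q : ι → ℤ := fun i => max (-c i) 0 with hq
  have hcpq : c = p - q := by
    funext i
    simp only [hp, hq, Pi.sub_apply]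
    omega
  have hp0 : intComb b p ≠ 0 := by
    intro h
    obtain ⟨i, hi⟩ := hc
    have h0 : intComb b (0 : ι → ℤ) = 0 := by simp [intComb]
    have := congrFun (intComb_injective hb (h.trans h0.symm)) i
    simp only [hp, Pi.zero_apply] at this
    omega
  have hpp : 0 < ⟪intComb b p, intComb b p⟫ := real_inner_self_pos.mpr hp0
  have hqp : ⟪intComb b q, intComb b p⟫ ≤ 0 := by
    rw [inner_intComb_right]
    refine Finset.sum_nonpos fun i _ => ?_
    rw [inner_intComb_left, Finset.mul_sum]
    refine Finset.sum_nonpos fun j _ => ?_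
    have hpi : (0 : ℝ) ≤ p i := by exact_mod_cast le_max_right _ _
    have hqj : (0 : ℝ) ≤ q j := by exact_mod_cast le_max_right _ _
    by_cases hij : j = i
    · subst hij
      have : p j = 0 ∨ q j = 0 := by simp only [hp, hq]; omega
      rcases this with h | h <;> simp [h]
    · exact mul_nonpos_of_nonneg_of_nonpos hpi
        (mul_nonpos_of_nonneg_of_nonpos hqj (hobt j i hij))
  have hle : ⟪intComb b c, intComb b p⟫ ≤ 0 := by
    rw [inner_intComb_right]
    refine Finset.sum_nonpos fun i _ => ?_
    by_cases hi : 0 < c i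
    · refine mul_nonpos_of_nonneg_of_nonpos ?_ (hcon i hi)
      exact_mod_cast le_max_right _ _
    · have : p i = 0 := by simp only [hp]; omega
      simp [this]
  rw [hcpq, intComb_sub, inner_sub_left] at hle
  linarith

variable [DecidableEq ι] {Φ Ψ : Set V} {b : ι → V}

lemma inner_nonpos_of_sign (hΨ : IsRootSystem Ψ) (hb : LinearIndependent ℝ b)
    (hbΨ : ∀ i, b i ∈ Ψ)
    (hsign : ∀ c : ι → ℤ, intComb b c ∈ Ψ → (∀ i, 0 ≤ c i) ∨ (∀ i, c i ≤ 0))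
    {i j : ι} (hij : i ≠ j) : ⟪b i, b j⟫ ≤ 0 := by
  by_contra! hpos
  have hmem := hΨ.sub_mem (hbΨ i) (hbΨ j) (hb.injective.ne hij) hpos
  have heq : intComb b (Pi.single i 1 - Pi.single j 1) = b i - b j := by
    simp [intComb_sub, intComb_single]
  rw [← heq] at hmem
  rcases hsign _ hmem with h | h
  · have := h j
    simp [Pi.single_eq_of_ne hij.symm] at this
  · have := h i
    simp [Pi.single_eq_of_ne hij] at this

/-- If smaller combinations are well behaved, subtracting a suitable `b i` from a root with
coefficients of both signs leaves only nonpositive coefficients. -/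
lemma exists_coeff_eq_one_of_mixed (hΦ : IsRootSystem Φ) (hΨΦ : Ψ ⊆ Φ)
    (hb : LinearIndependent ℝ b) (hbΨ : ∀ i, b i ∈ Ψ)
    (hsign : ∀ c : ι → ℤ, intComb b c ∈ Ψ → (∀ i, 0 ≤ c i) ∨ (∀ i, c i ≤ 0))
    (hobt : ∀ i j, i ≠ j → ⟪b i, b j⟫ ≤ 0) {c : ι → ℤ}
    (ih : ∀ d : ι → ℤ, coeffHeight d < coeffHeight c → intComb b d ∈ Φ → intComb b d ∈ Ψ)
    (hc : intComb b c ∈ Φ) (hpos : ∃ i, 0 < c i) (hneg : ∃ i, c i < 0) :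
    ∃ i, c i = 1 ∧ ∀ k, k ≠ i → c k ≤ 0 := by
  obtain ⟨i, hi, hin⟩ := exists_coeff_pos_inner_pos hb hobt hpos
  obtain ⟨j, hj⟩ := hneg
  have hji : j ≠ i := by rintro rfl; omega
  have heq : intComb b (c - Pi.single i 1) = intComb b c - b i := by
    simp [intComb_sub, intComb_single]
  have hne : intComb b c ≠ b i := by
    intro h
    have h1 : intComb b c = intComb b (Pi.single i 1) := by simp [intComb_single, h]
    have := congrFun (intComb_injective hb h1) j
    rw [Pi.single_eq_of_ne hji] at this
    omega
  have hmem := hΦ.sub_mem hc (hΨΦ (hbΨ i)) hne hin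
  rw [← heq] at hmem
  have hh := coeffHeight_sub_single c i 1
  rcases hsign _ (ih _ (by omega) hmem) with h | h
  · have := h j
    simp [Pi.single_eq_of_ne hji] at this
    omega
  · refine ⟨i, ?_, fun k hk => ?_⟩
    · have := h i
      simp at this
      omega
    · have := h k
      simpa [Pi.single_eq_of_ne hk] using this

lemma intComb_mem_of_mixed (hΦ : IsRootSystem Φ) (hΨΦ : Ψ ⊆ Φ)
    (hb : LinearIndependent ℝ b) (hbΨ : ∀ i, b i ∈ Ψ)
    (hsign : ∀ c : ι → ℤ, intComb b c ∈ Ψ → (∀ i, 0 ≤ c i) ∨ (∀ i, c i ≤ 0))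
    (hobt : ∀ i j, i ≠ j → ⟪b i, b j⟫ ≤ 0)
    (hpair : ∀ i j, b i - b j ∈ Φ → b i - b j ∈ Ψ) {c : ι → ℤ}
    (ih : ∀ d : ι → ℤ, coeffHeight d < coeffHeight c → intComb b d ∈ Φ → intComb b d ∈ Ψ)
    (hc : intComb b c ∈ Φ) (hpos : ∃ i, 0 < c i) (hneg : ∃ i, c i < 0) :
    intComb b c ∈ Ψ := by
  obtain ⟨i, hi, hi'⟩ :=
    exists_coeff_eq_one_of_mixed hΦ hΨΦ hb hbΨ hsign hobt ih hc hpos hneg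
  obtain ⟨j, hj, hj'⟩ :=
    exists_coeff_eq_one_of_mixed (c := -c) hΦ hΨΦ hb hbΨ hsign hobt
      (by rwa [coeffHeight_neg]) (by rw [intComb_neg]; exact hΦ.neg_mem hc)
      (by simpa using hneg) (by simpa using hpos)
  have hij : i ≠ j := by
    rintro rfl
    simp at hj
    omega
  have hceq : c = Pi.single i 1 - Pi.single j 1 := by
    funext k
    by_cases hki : k = i
    · subst hki
      simp [Pi.single_eq_of_ne hij, hi]
    by_cases hkj : k = j
    · subst hkj
      simp [Pi.single_eq_of_ne hij.symm] at hj ⊢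
      omega
    have h1 := hi' k hki
    have h2 := hj' k hkj
    simp [Pi.single_eq_of_ne hki, Pi.single_eq_of_ne hkj] at h2 ⊢
    omega
  have heq : intComb b c = b i - b j := by
    rw [hceq]
    simp [intComb_sub, intComb_single]
  rw [heq] at hc ⊢
  exact hpair i j hc

lemma intComb_mem_of_nonneg (hΦ : IsRootSystem Φ) (hΨ : IsRootSystem Ψ) (hΨΦ : Ψ ⊆ Φ)
    (hb : LinearIndependent ℝ b) (hbΨ : ∀ i, b i ∈ Ψ)
    (hsign : ∀ c : ι → ℤ, intComb b c ∈ Ψ → (∀ i, 0 ≤ c i) ∨ (∀ i, c i ≤ 0))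
    (hobt : ∀ i j, i ≠ j → ⟪b i, b j⟫ ≤ 0)
    (hpair : ∀ i j, b i - b j ∈ Φ → b i - b j ∈ Ψ) {c : ι → ℤ}
    (ih : ∀ d : ι → ℤ, coeffHeight d < coeffHeight c → intComb b d ∈ Φ → intComb b d ∈ Ψ)
    (hc : intComb b c ∈ Φ) (hnn : ∀ i, 0 ≤ c i) :
    intComb b c ∈ Ψ := by
  have hex : ∃ i, 0 < c i := by
    by_contra! h
    have h0 : c = 0 := funext fun i => le_antisymm (h i) (hnn i)
    exact hΦ.ne_zero hc (by simp [h0, intComb])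
  obtain ⟨i, hi, hin⟩ := exists_coeff_pos_inner_pos hb hobt hex
  have hbi0 := hΨ.ne_zero (hbΨ i)
  by_cases hoth : ∃ k, k ≠ i ∧ 0 < c k
  swap
  · push Not at hoth
    have hceq : c = Pi.single i (c i) := by
      funext k
      by_cases hki : k = i
      · subst hki; simp
      · rw [Pi.single_eq_of_ne hki]
        exact le_antisymm (hoth k hki) (hnn k)
    rw [hceq, intComb_single] at hc ⊢
    rcases hΦ.2.2.2.2 _ (hΨΦ (hbΨ i)) _ hc with h | h
    · rw [h]; exact hbΨ i
    · rw [h]; exact hΨ.neg_mem (hbΨ i)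
  obtain ⟨k, hki, hk⟩ := hoth
  have hne : intComb b c ≠ b i := by
    intro h
    have h1 : intComb b c = intComb b (Pi.single i 1) := by simp [intComb_single, h]
    have := congrFun (intComb_injective hb h1) k
    rw [Pi.single_eq_of_ne hki] at this
    omega
  have heq (m : ℤ) : intComb b (c - Pi.single i m) = intComb b c - (m : ℝ) • b i := by
    rw [intComb_sub, intComb_single]
  obtain ⟨n, hn⟩ := hΦ.2.2.2.1 _ (hΨΦ (hbΨ i)) _ hc
  have hn0 : 0 < n := by
    have : (0 : ℝ) < n := by
      rw [← hn, pairR]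
      have := real_inner_self_pos.mpr hbi0
      positivity
    exact_mod_cast this
  have hrefl : reflV (b i) (intComb b c) = intComb b (c - Pi.single i n) := by
    rw [reflV, hn, heq]
  have hreflΦ := hΦ.2.2.1 _ (hΨΦ (hbΨ i)) _ hc
  rw [hrefl] at hreflΦ
  suffices h : intComb b (c - Pi.single i n) ∈ Ψ by
    rw [← reflV_reflV hbi0 (intComb b c), hrefl]
    exact hΨ.2.2.1 _ (hbΨ i) _ h
  have hh := coeffHeight_sub_single c i n
  by_cases hlt : n < 2 * c i
  · exact ih _ (by omega) hreflΦ
  have hsub : intComb b c - (1 : ℝ) • b i ∈ Ψ := by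
    have := hΦ.sub_mem hc (hΨΦ (hbΨ i)) hne hin
    have h1 := heq 1
    have hh1 := coeffHeight_sub_single c i 1
    rw [Int.cast_one] at h1
    rw [← h1]
    refine ih _ (by omega) ?_
    rwa [h1, one_smul]
  have hrefl' := hΨ.2.2.1 _ (hbΨ i) _ hsub
  have hform : reflV (b i) (intComb b c - (1 : ℝ) • b i)
      = intComb b (c - Pi.single i (n - 1)) := by
    rw [reflV, pairR_sub_smul_self hbi0, hn, heq]
    push_cast
    module
  rw [hform] at hrefl'
  have hle : n - 1 ≤ c i := by
    rcases hsign _ hrefl' with h | h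
    · have := h i
      simp at this
      omega
    · have := h k
      simp [Pi.single_eq_of_ne hki] at this
      omega
  refine intComb_mem_of_mixed hΦ hΨΦ hb hbΨ hsign hobt hpair ?_ hreflΦ ⟨k, ?_⟩ ⟨i, ?_⟩
  · intro d hd
    exact ih d (by omega)
  · simpa [Pi.single_eq_of_ne hki] using hk
  · simp
    omega

/-- A root that is an integral combination of a base of a subsystem lies in the subsystem, provided
differences of base elements do. -/
lemma intComb_mem (hΦ : IsRootSystem Φ) (hΨ : IsRootSystem Ψ) (hΨΦ : Ψ ⊆ Φ)
    (hb : LinearIndependent ℝ b) (hbΨ : ∀ i, b i ∈ Ψ)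
    (hsign : ∀ c : ι → ℤ, intComb b c ∈ Ψ → (∀ i, 0 ≤ c i) ∨ (∀ i, c i ≤ 0))
    (hpair : ∀ i j, b i - b j ∈ Φ → b i - b j ∈ Ψ) (c : ι → ℤ)
    (hc : intComb b c ∈ Φ) : intComb b c ∈ Ψ := by
  have hobt : ∀ i j, i ≠ j → ⟪b i, b j⟫ ≤ 0 := fun i j hij =>
    inner_nonpos_of_sign hΨ hb hbΨ hsign hij
  induction hN : coeffHeight c using Nat.strong_induction_on generalizing c with
  | _ N ih =>
  subst hN
  have ih' : ∀ d : ι → ℤ, coeffHeight d < coeffHeight c → intComb b d ∈ Φ →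
      intComb b d ∈ Ψ := fun d hd hdΦ => ih _ hd d hdΦ rfl
  by_cases hneg : ∃ i, c i < 0
  · by_cases hpos : ∃ i, 0 < c i
    · exact intComb_mem_of_mixed hΦ hΨΦ hb hbΨ hsign hobt hpair ih' hc hpos hneg
    · push Not at hpos
      have := intComb_mem_of_nonneg (c := -c) hΦ hΨ hΨΦ hb hbΨ hsign hobt hpair
        (by rwa [coeffHeight_neg]) (by rw [intComb_neg]; exact hΦ.neg_mem hc)
        (by simpa using hpos)
      rw [intComb_neg] at this
      simpa using hΨ.neg_mem this
  · push Not at hneg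
    exact intComb_mem_of_nonneg hΦ hΨ hΨΦ hb hbΨ hsign hobt hpair ih' hc hneg

end Combinations

lemma finsupp_sum_eq_intComb {S : Set V} [Fintype S] {c : V →₀ ℤ}
    (hc : (↑c.support : Set V) ⊆ S) :
    c.sum (fun v n => (n : ℝ) • v) = intComb ((↑) : S → V) (fun i => c i) := by
  classical
  have hsub : c.support ⊆ S.toFinset := fun v hv => by simpa using hc hv
  rw [Finsupp.sum_of_support_subset c hsub _ (by simp), intComb,
    Finset.sum_subtype S.toFinset (p := (· ∈ S)) (by simp)]

/-- a root subsystem `Ψ` of `Φ` with base `Sg` is additively closed in `Φ`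
iff for all `σ, τ ∈ Sg` the root subsystem `Ψ ∩ (ℝσ + ℝτ)` is additively closed in `Φ`. -/
theorem stmt1 {V : Type*} [NormedAddCommGroup V] [InnerProductSpace ℝ V]
    [FiniteDimensional ℝ V] (Φ Ψ Sg : Set V)
    (hΦ : IsRootSystem Φ) (hΨ : IsRootSubsystem Φ Ψ) (hSg : IsBase Ψ Sg) :
    IsAddClosedIn Φ Ψ ↔
      ∀ σ ∈ Sg, ∀ τ ∈ Sg,
        IsAddClosedIn Φ (Ψ ∩ (Submodule.span ℝ ({σ, τ} : Set V) : Set V)) := by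
  classical
  constructor
  · intro hcl σ _ τ _
    refine Set.Subset.antisymm (fun x hx => ⟨hΨ.1 hx.1, Submodule.subset_span hx⟩) ?_
    rintro x ⟨hxΦ, hx⟩
    refine ⟨?_, ?_⟩
    · rw [hcl]
      exact ⟨hxΦ, Submodule.span_mono Set.inter_subset_left hx⟩
    · have hle : Submodule.span ℤ (Ψ ∩ (Submodule.span ℝ ({σ, τ} : Set V) : Set V))
          ≤ (Submodule.span ℝ ({σ, τ} : Set V)).restrictScalars ℤ :=
        Submodule.span_le.mpr Set.inter_subset_right
      exact hle hx
  · intro hpairs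
    obtain ⟨hSΨ, hli, -, hcoef⟩ := hSg
    have hΨ' := hΨ.isRootSystem hΦ
    have : Fintype Sg := (hΨ'.1.subset hSΨ).fintype
    have hsign : ∀ c : Sg → ℤ, intComb ((↑) : Sg → V) c ∈ Ψ →
        (∀ i, 0 ≤ c i) ∨ (∀ i, c i ≤ 0) := by
      intro c hc
      obtain ⟨d, hd, hcd, hsgn⟩ := hcoef _ hc
      rw [finsupp_sum_eq_intComb hd] at hcd
      rw [intComb_injective hli hcd]
      exact hsgn.imp (fun h i => h i) (fun h i => h i)
    have hpair : ∀ i j : Sg, (i : V) - j ∈ Φ → (i : V) - j ∈ Ψ := by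
      intro i j hij
      have hcl := hpairs i i.2 j j.2
      have hi : (i : V) ∈ Ψ ∩ (Submodule.span ℝ ({(i : V), (j : V)} : Set V) : Set V) :=
        ⟨hSΨ i.2, Submodule.subset_span (by simp)⟩
      have hj : (j : V) ∈ Ψ ∩ (Submodule.span ℝ ({(i : V), (j : V)} : Set V) : Set V) :=
        ⟨hSΨ j.2, Submodule.subset_span (by simp)⟩
      have hmem := hcl.symm.subset ⟨hij, sub_mem (Submodule.subset_span hi)
        (Submodule.subset_span hj)⟩
      exact hmem.1
    refine Set.Subset.antisymm (fun x hx => ⟨hΨ.1 hx, Submodule.subset_span hx⟩) ?_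
    rintro x ⟨hxΦ, hx⟩
    have hspan : Submodule.span ℤ Ψ ≤ Submodule.span ℤ (Set.range ((↑) : Sg → V)) := by
      refine Submodule.span_le.mpr fun α hα => ?_
      obtain ⟨d, hd, hαd, -⟩ := hcoef α hα
      rw [finsupp_sum_eq_intComb hd] at hαd
      refine (Submodule.mem_span_range_iff_exists_fun ℤ).mpr ⟨fun i => d i, ?_⟩
      simp [hαd, intComb, Int.cast_smul_eq_zsmul]
    obtain ⟨c, hc⟩ := (Submodule.mem_span_range_iff_exists_fun ℤ).mp (hspan hx)
    have hxc : x = intComb ((↑) : Sg → V) c := by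
      simp [← hc, intComb, Int.cast_smul_eq_zsmul]
    rw [hxc] at hxΦ ⊢
    exact intComb_mem hΦ hΨ' hΨ.1 hli (fun i => hSΨ i.2) hsign hpair c hxΦ
end
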